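/- Let X be a nonempty compact metric space and Φ = {φ_1,…,φ_ℓ} a finite family of continuous self-maps of X. Suppose there is a nonempty subfamily Ψ ⊆ Φ such that every ψ ∈ Ψ is a contraction (Lipschitz with constant strictly less than 1), and X is an attractor of the IFS (X,Ψ⁺): d_H(F_Ψ^j(B), X) → 0 as j → ∞ for every B ∈ K(X). Then every singleton {x}, x ∈ X, is an equicontinuous point of (K(X), F_Φ): for every ε > 0 there exists δ > 0 such that every y ∈ X with d(x,y) < δ satisfies sup_{i≥0} d_H(F_Φ^i({x}), F_Φ^i({y})) < ε. -/

import Mathlib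

open Metric Set Function Filter

/-- `f` belongs to the semigroup `Φ⁺` generated by `Φ` under composition:
`f` is a composition of a nonempty finite list of members of `Φ`. -/
def InSemigroup {X : Type*} (Φ : Set (X → X)) (f : X → X) : Prop :=
  ∃ l : List (X → X), l ≠ [] ∧ (∀ g ∈ l, g ∈ Φ) ∧ f = l.foldr (· ∘ ·) id

/-- The Hutchinson operator associated with `Φ`: `F(Y)` is the closure of `⋃ φ ∈ Φ, φ(Y)`. -/
def Hutch {X : Type*} [TopologicalSpace X] (Φ : Set (X → X)) (Y : Set X) : Set X :=
  closure (⋃ φ ∈ Φ, φ '' Y)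

/-- The IFS `(X, Φ⁺)` is forward minimal: `X` contains no nonempty proper closed subset
which is forward invariant under every member of `Φ`. -/
def ForwardMinimal {X : Type*} [TopologicalSpace X] (Φ : Set (X → X)) : Prop :=
  ∀ A : Set X, A.Nonempty → IsClosed A → (∀ φ ∈ Φ, φ '' A ⊆ A) → A = Set.univ

/-- `p` is an attracting fixed point of `φ`: `φ p = p` and there is an open set `U ∋ p`
with `φ(closure U) ⊆ U` and `⋂ n, φ^n(U) = {p}`. -/
def AttractingFixedPoint {X : Type*} [TopologicalSpace X] (φ : X → X) (p : X) : Prop :=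
  φ p = p ∧ ∃ U : Set X, IsOpen U ∧ p ∈ U ∧ φ '' closure U ⊆ U ∧ (⋂ n : ℕ, φ^[n] '' U) = {p}

theorem Hutch.mono {X : Type*} [TopologicalSpace X] {Φ Ψ : Set (X → X)} {A B : Set X}
    (hΨΦ : Ψ ⊆ Φ) (hAB : A ⊆ B) : Hutch Ψ A ⊆ Hutch Φ B :=
  closure_mono (biUnion_mono hΨΦ fun _ _ => image_mono hAB)

theorem Hutch.iterate_subset_iterate {X : Type*} [TopologicalSpace X] {Φ Ψ : Set (X → X)}
    (hΨΦ : Ψ ⊆ Φ) (n : ℕ) (A : Set X) : (Hutch Ψ)^[n] A ⊆ (Hutch Φ)^[n] A :=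
  Monotone.iterate_le_of_le (fun _ _ h => Hutch.mono subset_rfl h)
    (fun _ => Hutch.mono hΨΦ subset_rfl) n A

theorem Hutch.iterate_nonempty {X : Type*} [TopologicalSpace X] {Φ : Set (X → X)}
    (hΦ : Φ.Nonempty) {A : Set X} (hA : A.Nonempty) (n : ℕ) : ((Hutch Φ)^[n] A).Nonempty := by
  induction n with
  | zero => exact hA
  | succ n ih =>
    rw [iterate_succ_apply']
    obtain ⟨φ, hφ⟩ := hΦ
    obtain ⟨a, ha⟩ := ih
    exact ⟨φ a, subset_closure (mem_biUnion hφ (mem_image_of_mem φ ha))⟩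

/-- A family with a common modulus of continuity `(ε, δ')` induces a Hutchinson operator
with the same modulus. -/
theorem Hutch.subset_cthickening {X : Type*} [PseudoMetricSpace X] {Φ : Set (X → X)} {ε δ δ' : ℝ}
    (hΦ : ∀ φ ∈ Φ, ∀ a b, dist a b < δ' → dist (φ a) (φ b) < ε) (hδ' : 0 < δ') (hδ : δ < δ')
    {A B : Set X} (hAB : A ⊆ cthickening δ B) : Hutch Φ A ⊆ cthickening ε (Hutch Φ B) := by
  refine closure_minimal (iUnion₂_subset fun φ hφ => ?_) isClosed_cthickening
  rintro _ ⟨a, ha, rfl⟩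
  obtain ⟨b, hb, hab⟩ := mem_thickening_iff.1 (cthickening_subset_thickening' hδ' hδ B (hAB ha))
  exact thickening_subset_cthickening _ _ (mem_thickening_iff.2
    ⟨φ b, subset_closure (mem_biUnion hφ (mem_image_of_mem φ hb)), hΦ φ hφ a b hab⟩)

theorem Hutch.iterate_subset_cthickening_of_nonexpansive {X : Type*} [PseudoMetricSpace X]
    {Ψ : Set (X → X)} (hΨ : ∀ ψ ∈ Ψ, ∀ a b, dist (ψ a) (ψ b) ≤ dist a b) {δ : ℝ} (hδ : 0 ≤ δ)
    {A B : Set X} (hAB : A ⊆ cthickening δ B) (n : ℕ) :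
    (Hutch Ψ)^[n] A ⊆ cthickening δ ((Hutch Ψ)^[n] B) := by
  induction n with
  | zero => exact hAB
  | succ n ih =>
    rw [iterate_succ_apply', iterate_succ_apply', cthickening_eq_iInter_cthickening]
    exact subset_iInter₂ fun δ' hδ' => Hutch.subset_cthickening
      (fun ψ hψ a b h => (hΨ ψ hψ a b).trans_lt h) (hδ.trans_lt hδ') hδ' ih

theorem Hutch.exists_iterate_subset_cthickening {X : Type*} [PseudoMetricSpace X] [CompactSpace X]
    {Φ : Set (X → X)} (hΦfin : Φ.Finite) (hΦcont : ∀ φ ∈ Φ, Continuous φ) (n : ℕ) {ε : ℝ}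
    (hε : 0 < ε) : ∃ δ > 0, ∀ A B : Set X, A ⊆ cthickening δ B →
      (Hutch Φ)^[n] A ⊆ cthickening ε ((Hutch Φ)^[n] B) := by
  induction n generalizing ε with
  | zero => exact ⟨ε, hε, fun _ _ h => h⟩
  | succ n ih =>
    have hev : ∀ᶠ p in uniformity X, ∀ φ ∈ Φ, dist (φ p.1) (φ p.2) < ε :=
      (eventually_all_finite hΦfin).2 fun φ hφ =>
        CompactSpace.uniformContinuous_of_continuous (hΦcont φ hφ) (dist_mem_uniformity hε)
    obtain ⟨δ', hδ', hmod⟩ := Metric.mem_uniformity_dist.1 hev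
    obtain ⟨δ, hδ, h⟩ := ih (half_pos hδ')
    refine ⟨δ, hδ, fun A B hAB => ?_⟩
    rw [iterate_succ_apply', iterate_succ_apply']
    exact Hutch.subset_cthickening (fun φ hφ a b hab => hmod hab φ hφ) hδ' (half_lt_self hδ')
      (h A B hAB)

theorem hausdorffDist_le_of_subset_cthickening {X : Type*} [PseudoMetricSpace X] {r : ℝ}
    (hr : 0 ≤ r) {A B : Set X} (hAB : A ⊆ cthickening r B) (hBA : B ⊆ cthickening r A) :
    hausdorffDist A B ≤ r :=
  ENNReal.toReal_le_of_le_ofReal hr (hausdorffEDist_le_of_infEDist hAB hBA)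

/-- Let `Ψ ⊆ Φ` be a nonempty subfamily consisting of contractions such that
`X` is an attractor of the IFS `(X, Ψ⁺)`. Then every singleton `{x}` is an equicontinuous point
of `(K(X), F_Φ)`. -/
theorem stmt11 {X : Type*} [MetricSpace X] [CompactSpace X] [Nonempty X]
    (Φ Ψ : Set (X → X)) (hΦfin : Φ.Finite) (hΦcont : ∀ φ ∈ Φ, Continuous φ)
    (hΨΦ : Ψ ⊆ Φ) (hΨne : Ψ.Nonempty)
    (hcontr : ∀ ψ ∈ Ψ, ∃ c : ℝ, c < 1 ∧ ∀ x y : X, dist (ψ x) (ψ y) ≤ c * dist x y)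
    (hattr : ∀ B : Set X, B.Nonempty → IsCompact B →
      Filter.Tendsto (fun j : ℕ => hausdorffDist ((Hutch Ψ)^[j] B) (Set.univ : Set X))
        Filter.atTop (nhds 0)) :
    ∀ x : X, ∀ ε > (0 : ℝ), ∃ δ > (0 : ℝ), ∀ y : X, dist x y < δ →
      ∀ i : ℕ, hausdorffDist ((Hutch Φ)^[i] ({x} : Set X)) ((Hutch Φ)^[i] {y}) < ε := by
  intro x ε hε
  have hΨ : ∀ ψ ∈ Ψ, ∀ a b, dist (ψ a) (ψ b) ≤ dist a b := fun ψ hψ a b => by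
    obtain ⟨c, hc, h⟩ := hcontr ψ hψ
    exact (h a b).trans (mul_le_of_le_one_left dist_nonneg hc.le)
  have hε4 : 0 < ε / 4 := by positivity
  have hmem : ∀ {δ : ℝ} {a b : X}, dist a b ≤ δ → ({a} : Set X) ⊆ cthickening δ {b} :=
    fun h => singleton_subset_iff.2 (mem_cthickening_of_dist_le _ _ _ _ rfl h)
  obtain ⟨N, hN⟩ := eventually_atTop.1
    ((hattr {x} (singleton_nonempty x) isCompact_singleton).eventually_lt_const hε4)
  have hdense : ∀ y, dist x y ≤ ε / 4 → ∀ i ≥ N,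
      (univ : Set X) ⊆ cthickening (ε / 2) ((Hutch Φ)^[i] {y}) := by
    intro y hy i hi
    have hx : (univ : Set X) ⊆ cthickening (ε / 4) ((Hutch Ψ)^[i] {x}) := fun z hz => by
      obtain ⟨w, hw, hwz⟩ := exists_dist_lt_of_hausdorffDist_lt' hz (hN i hi)
        (hausdorffEDist_ne_top_of_nonempty_of_bounded
          (Hutch.iterate_nonempty hΨne (singleton_nonempty x) i) univ_nonempty
          isBounded_of_compactSpace isBounded_of_compactSpace)
      exact mem_cthickening_of_dist_le _ _ _ _ hw (by rw [dist_comm]; exact hwz.le)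
    calc (univ : Set X) ⊆ cthickening (ε / 4) ((Hutch Ψ)^[i] {x}) := hx
      _ ⊆ cthickening (ε / 4) (cthickening (ε / 4) ((Hutch Ψ)^[i] {y})) :=
        cthickening_subset_of_subset _
          (Hutch.iterate_subset_cthickening_of_nonexpansive hΨ hε4.le (hmem hy) i)
      _ ⊆ cthickening (ε / 4 + ε / 4) ((Hutch Ψ)^[i] {y}) :=
        cthickening_cthickening_subset hε4.le hε4.le _
      _ ⊆ cthickening (ε / 2) ((Hutch Φ)^[i] {y}) := by
        rw [show ε / 4 + ε / 4 = ε / 2 by ring]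
        exact cthickening_subset_of_subset _ (Hutch.iterate_subset_iterate hΨΦ i _)
  have hinit : ∀ᶠ y in nhds x, ∀ i ∈ Iio N,
      hausdorffDist ((Hutch Φ)^[i] {x}) ((Hutch Φ)^[i] {y}) < ε := by
    refine (eventually_all_finite (finite_Iio N)).2 fun i _ => ?_
    obtain ⟨δ, hδ, h⟩ := Hutch.exists_iterate_subset_cthickening hΦfin hΦcont i (half_pos hε)
    filter_upwards [ball_mem_nhds x hδ] with y hy
    have hyx : dist y x ≤ δ := (mem_ball.1 hy).le
    exact (hausdorffDist_le_of_subset_cthickening (half_pos hε).le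
      (h _ _ (hmem (by rwa [dist_comm]))) (h _ _ (hmem hyx))).trans_lt (half_lt_self hε)
  obtain ⟨δ, hδ, h⟩ := Metric.eventually_nhds_iff.1 hinit
  refine ⟨min δ (ε / 4), lt_min hδ hε4, fun y hy i => ?_⟩
  rcases lt_or_ge i N with hi | hi
  · exact h (by rw [dist_comm]; exact hy.trans_le (min_le_left _ _)) i hi
  · refine (hausdorffDist_le_of_subset_cthickening (half_pos hε).le ?_ ?_).trans_lt
      (half_lt_self hε)
    · exact (subset_univ _).trans (hdense y (hy.le.trans (min_le_right _ _)) i hi)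
    · exact (subset_univ _).trans (hdense x (by simpa using hε4.le) i hi)
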